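/- arXiv:1409.6354 — 4 statements merged into one kernel-verified Lean document; each statement's English description precedes it below -/
import Mathlib

section
/- If the constant input flow {d_l}_{l∈R} is feasible, then the equilibrium flow on the ordinary links is unique, given by fe_O = (I − A)^{-1} B d, and it satisfies (I − A)^{-1} B d ≤ Φcrit componentwise. (Proposition 2, uniqueness and necessity) -/
open scoped BigOperators ENNReal

/-- A traffic network: a finite directed acyclic graph with junctions `V`,
ordinary links `O` and onramps `R`, together with jam densities, demand and
supply functions and split ratios, satisfying the standing assumptions of the
model (Assumptions 1–3 and the structural assumptions). -/
structure TrafficNetwork (V O R : Type) [Fintype V] [Fintype O] [Fintype R]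
    [DecidableEq V] [DecidableEq O] [DecidableEq R] where
  /-- head junction of each link -/
  head : O ⊕ R → V
  /-- tail junction of each ordinary link (onramps have no tail) -/
  tail : O → V
  /-- jam density of each ordinary link -/
  ρjam : O → ℝ
  /-- demand function of each link -/
  Φout : O ⊕ R → ℝ → ℝ
  /-- supply function of each ordinary link -/
  Φin : O → ℝ → ℝ
  /-- split ratios -/
  β : O ⊕ R → O → ℝ
  ρjam_pos : ∀ l, 0 < ρjam l
  Φout_strictMono : ∀ l : O, StrictMonoOn (Φout (Sum.inl l)) (Set.Icc 0 (ρjam l))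
  Φout_zero : ∀ l : O ⊕ R, Φout l 0 = 0
  Φout_nonneg : ∀ l : O, ∀ x ∈ Set.Icc 0 (ρjam l), 0 ≤ Φout (Sum.inl l) x
  Φin_strictAnti : ∀ l : O, StrictAntiOn (Φin l) (Set.Icc 0 (ρjam l))
  Φin_nonneg : ∀ l : O, ∀ x ∈ Set.Icc 0 (ρjam l), 0 ≤ Φin l x
  Φin_jam : ∀ l : O, Φin l (ρjam l) = 0
  ΦoutR_strictMono : ∀ r : R, StrictMonoOn (Φout (Sum.inr r)) (Set.Ici 0)
  ΦoutR_nonneg : ∀ r : R, ∀ x ∈ Set.Ici (0 : ℝ), 0 ≤ Φout (Sum.inr r) x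
  ΦoutR_bddAbove : ∀ r : R, BddAbove (Φout (Sum.inr r) '' Set.Ici 0)
  β_nonneg : ∀ l k, 0 ≤ β l k
  β_le_one : ∀ l k, β l k ≤ 1
  β_support : ∀ l k, 0 < β l k → head l = tail k
  β_pos : ∀ (l : O ⊕ R) (k : O), head l = tail k → 0 < β l k
  β_sum_le_one : ∀ l : O ⊕ R,
    ∑ k ∈ Finset.univ.filter (fun k : O => tail k = head l), β l k ≤ 1
  acyclic : ∃ rank : V → ℕ, ∀ l : O, rank (tail l) < rank (head (Sum.inl l))
  Lin_nonempty : ∀ v : V, ∃ l : O ⊕ R, head l = v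
  ramp_out_nonempty : ∀ r : R, ∃ k : O, tail k = head (Sum.inr r)

namespace TrafficNetwork

variable {V O R : Type} [Fintype V] [Fintype O] [Fintype R]
  [DecidableEq V] [DecidableEq O] [DecidableEq R]
variable (N : TrafficNetwork V O R)

/-- links incoming to a junction -/
def Lin (v : V) : Finset (O ⊕ R) := Finset.univ.filter (fun l => N.head l = v)

/-- (ordinary) links outgoing from a junction -/
def Lout (v : V) : Finset O := Finset.univ.filter (fun k => N.tail k = v)

/-- continuous differentiability of supply and demand on the interiors of their domains -/
def C1 : Prop :=
  (∀ l : O, ContDiffOn ℝ 1 (N.Φout (Sum.inl l)) (Set.Ioo 0 (N.ρjam l))) ∧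
  (∀ l : O, ContDiffOn ℝ 1 (N.Φin l) (Set.Ioo 0 (N.ρjam l))) ∧
  (∀ r : R, ContDiffOn ℝ 1 (N.Φout (Sum.inr r)) (Set.Ioi 0))

/-- the derivative bounds of Assumption 1 -/
def DerivBounds : Prop :=
  (∀ l : O, ∃ M : ℝ, ∀ x ∈ Set.Ioo 0 (N.ρjam l),
      derivWithin (N.Φout (Sum.inl l)) (Set.Ioo 0 (N.ρjam l)) x ≤ M) ∧
  (∀ l : O, ∃ M : ℝ, ∀ x ∈ Set.Ioo 0 (N.ρjam l),
      M ≤ derivWithin (N.Φin l) (Set.Ioo 0 (N.ρjam l)) x) ∧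
  (∀ r : R, ∃ M : ℝ, 0 < M ∧ ∀ x ∈ Set.Ioi (0 : ℝ),
      derivWithin (N.Φout (Sum.inr r)) (Set.Ioi 0) x ≤ M / (1 + x) ^ 2)

/-- full regularity (Assumption 1) -/
def Regular : Prop := N.C1 ∧ N.DerivBounds

/-- For a vector of link demands `δ` and ordinary densities `ρO`, the PP/FIFO scale
factor at junction `v`: the largest `α ∈ [0,1]` such that
`α ⬝ Σ_{j ∈ L^in_v} β_{jk} δ_j ≤ Φin_k(ρ_k)` for every `k ∈ L^out_v`.
(If `L^out_v = ∅` this equals `1`.) -/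
noncomputable def αgen (δ : O ⊕ R → ℝ) (ρO : O → ℝ) (v : V) : ℝ :=
  sSup {a : ℝ | a ∈ Set.Icc (0 : ℝ) 1 ∧
    ∀ k ∈ N.Lout v, a * ∑ j ∈ N.Lin v, N.β j k * δ j ≤ N.Φin k (ρO k)}

/-- generic PP/FIFO outflow given demands `δ` and ordinary densities `ρO` -/
noncomputable def foutGen (δ : O ⊕ R → ℝ) (ρO : O → ℝ) (l : O ⊕ R) : ℝ :=
  N.αgen δ ρO (N.head l) * δ l

/-- generic PP/FIFO inflow of an ordinary link -/
noncomputable def finGen (δ : O ⊕ R → ℝ) (ρO : O → ℝ) (l : O) : ℝ :=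
  ∑ k ∈ N.Lin (N.tail l), N.β k l * N.foutGen δ ρO k

/-- link demands at density `ρ` -/
def demand (ρ : O ⊕ R → ℝ) (l : O ⊕ R) : ℝ := N.Φout l (ρ l)

/-- PP/FIFO scale factor at junction `v` at density `ρ` -/
noncomputable def αjunc (ρ : O ⊕ R → ℝ) (v : V) : ℝ :=
  N.αgen (N.demand ρ) (fun k => ρ (Sum.inl k)) v

/-- PP/FIFO outflow `fout_l(ρ)` -/
noncomputable def fout (ρ : O ⊕ R → ℝ) : O ⊕ R → ℝ :=
  N.foutGen (N.demand ρ) (fun k => ρ (Sum.inl k))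

/-- PP/FIFO inflow `fin_l(ρ)` of an ordinary link -/
noncomputable def fin (ρ : O ⊕ R → ℝ) (l : O) : ℝ :=
  N.finGen (N.demand ρ) (fun k => ρ (Sum.inl k)) l

/-- the state space `D` -/
def memD (ρ : O ⊕ R → ℝ) : Prop :=
  (∀ r : R, 0 ≤ ρ (Sum.inr r)) ∧ ∀ l : O, ρ (Sum.inl l) ∈ Set.Icc 0 (N.ρjam l)

/-- the state space `D` as a set -/
def Dset : Set (O ⊕ R → ℝ) := {ρ | N.memD ρ}

/-- `ρe ∈ D` is an equilibrium density for the constant input flow `d` -/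
def IsEquilibrium (d : R → ℝ) (ρe : O ⊕ R → ℝ) : Prop :=
  N.memD ρe ∧ (∀ r : R, N.fout ρe (Sum.inr r) = d r) ∧
    ∀ l : O, N.fout ρe (Sum.inl l) = N.fin ρe l

/-- the input flow `d` is feasible -/
def Feasible (d : R → ℝ) : Prop := ∃ ρe, N.IsEquilibrium d ρe

/-- `x` is the critical density of ordinary link `l`, where demand equals supply;
`Φcrit_l = Φout_l x = Φin_l x`. -/
def IsCrit (l : O) (x : ℝ) : Prop :=
  x ∈ Set.Icc 0 (N.ρjam l) ∧ N.Φout (Sum.inl l) x = N.Φin l x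

/-- supremum `Φ̄out_r` of the demand of onramp `r` -/
noncomputable def Φbar (r : R) : ℝ := sSup (N.Φout (Sum.inr r) '' Set.Ici 0)

/-- the routing matrix `A`, `A_{lk} = β_{kl}` for `l,k ∈ O` -/
def Amat : Matrix O O ℝ := Matrix.of fun l k => N.β (Sum.inl k) l

/-- the input routing matrix `B`, `B_{lr} = β_{rl}` for `l ∈ O`, `r ∈ R` -/
def Bmat : Matrix O R ℝ := Matrix.of fun l r => N.β (Sum.inr r) l

/-- the vector field `F` of the dynamics `ρ̇ = F(ρ)` with constant input `d` -/
noncomputable def Fvec (d : R → ℝ) (ρ : O ⊕ R → ℝ) : O ⊕ R → ℝ :=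
  Sum.elim (fun l => N.fin ρ l - N.fout ρ (Sum.inl l))
    (fun r => d r - N.fout ρ (Sum.inr r))

/-- `ρ : ℝ → D` is a trajectory of the network dynamics (for `t ≥ 0`) -/
noncomputable def IsTrajectory (d : R → ℝ) (ρ : ℝ → O ⊕ R → ℝ) : Prop :=
  ∀ t : ℝ, 0 ≤ t → HasDerivAt ρ (N.Fvec d (ρ t)) t

/-! ### Generalized (extended) state allowing infinite onramp densities -/

/-- demand vector for an extended state, where an onramp with infinite density
has demand `Φ̄out` -/
noncomputable def δext (ρO : O → ℝ) (ρR : R → ℝ≥0∞) : O ⊕ R → ℝ :=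
  Sum.elim (fun l => N.Φout (Sum.inl l) (ρO l))
    (fun r => if ρR r = ⊤ then N.Φbar r else N.Φout (Sum.inr r) (ρR r).toReal)

/-- PP/FIFO outflow at an extended state -/
noncomputable def foutExt (ρO : O → ℝ) (ρR : R → ℝ≥0∞) : O ⊕ R → ℝ :=
  N.foutGen (N.δext ρO ρR) ρO

/-- PP/FIFO inflow at an extended state -/
noncomputable def finExt (ρO : O → ℝ) (ρR : R → ℝ≥0∞) (l : O) : ℝ :=
  N.finGen (N.δext ρO ρR) ρO l

/-- generalized equilibrium (Definition 3): ordinary links balance and each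
onramp either transmits its input flow or has infinite density -/
def IsGenEquilibrium (d : R → ℝ) (ρO : O → ℝ) (ρR : R → ℝ≥0∞) : Prop :=
  (∀ l : O, ρO l ∈ Set.Icc 0 (N.ρjam l)) ∧
  (∀ l : O, N.foutExt ρO ρR (Sum.inl l) = N.finExt ρO ρR l) ∧
  (∀ r : R, N.foutExt ρO ρR (Sum.inr r) = d r ∨
      (N.foutExt ρO ρR (Sum.inr r) < d r ∧ ρR r = ⊤))

/-! ### Ramp metering -/

/-- demand vector for the metered network with metering rates `m` -/
noncomputable def δextM (m : R → ℝ) (ρO : O → ℝ) (ρR : R → ℝ≥0∞) : O ⊕ R → ℝ :=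
  Sum.elim (fun l => N.Φout (Sum.inl l) (ρO l))
    (fun r => min (if ρR r = ⊤ then N.Φbar r else N.Φout (Sum.inr r) (ρR r).toReal) (m r))

/-- PP/FIFO outflow of the metered network -/
noncomputable def foutM (m : R → ℝ) (ρO : O → ℝ) (ρR : R → ℝ≥0∞) : O ⊕ R → ℝ :=
  N.foutGen (N.δextM m ρO ρR) ρO

/-- PP/FIFO inflow of the metered network -/
noncomputable def finM (m : R → ℝ) (ρO : O → ℝ) (ρR : R → ℝ≥0∞) (l : O) : ℝ :=
  N.finGen (N.δextM m ρO ρR) ρO l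

/-- generalized equilibrium of the metered network -/
def IsGenEquilibriumM (m : R → ℝ) (d : R → ℝ) (ρO : O → ℝ) (ρR : R → ℝ≥0∞) : Prop :=
  (∀ l : O, ρO l ∈ Set.Icc 0 (N.ρjam l)) ∧
  (∀ l : O, N.foutM m ρO ρR (Sum.inl l) = N.finM m ρO ρR l) ∧
  (∀ r : R, N.foutM m ρO ρR (Sum.inr r) = d r ∨
      (N.foutM m ρO ρR (Sum.inr r) < d r ∧ ρR r = ⊤))

end TrafficNetwork

namespace TrafficNetwork

variable {V O R : Type} [Fintype V] [Fintype O] [Fintype R]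
  [DecidableEq V] [DecidableEq O] [DecidableEq R] (N : TrafficNetwork V O R)

theorem β_eq_zero_of_head_ne_tail {l : O ⊕ R} {k : O} (h : N.head l ≠ N.tail k) :
    N.β l k = 0 :=
  le_antisymm (not_lt.mp fun hpos => h (N.β_support l k hpos)) (N.β_nonneg l k)

/-- A sum weighted by the split ratios towards `k` only sees the links entering the tail of `k`. -/
theorem sum_Lin_β_mul (g : O ⊕ R → ℝ) (k : O) :
    ∑ j ∈ N.Lin (N.tail k), N.β j k * g j = ∑ j, N.β j k * g j := by
  refine Finset.sum_subset (Finset.subset_univ _) fun j _ hj => ?_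
  have hne : N.head j ≠ N.tail k := by simpa [Lin] using hj
  rw [N.β_eq_zero_of_head_ne_tail hne, zero_mul]

/-- `I - A` is invertible because the network is acyclic. -/
theorem isUnit_one_sub_Amat : IsUnit (1 - N.Amat) := by
  rw [← Matrix.mulVec_injective_iff_isUnit]
  refine (injective_iff_map_eq_zero (1 - N.Amat).mulVecLin).mpr fun x hx => ?_
  have hfix : ∀ l, x l = ∑ k, N.β (Sum.inl k) l * x k := fun l => by
    have hl := congrFun hx l
    simp only [Matrix.mulVecLin_apply, Matrix.sub_mulVec, Matrix.one_mulVec, Pi.sub_apply,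
      Pi.zero_apply, sub_eq_zero] at hl
    simpa [Matrix.mulVec, dotProduct, Amat] using hl
  obtain ⟨rank, hrank⟩ := N.acyclic
  have hzero : ∀ n, ∀ l, rank (N.tail l) = n → x l = 0 := by
    intro n
    induction n using Nat.strong_induction_on with
    | _ n ih =>
      intro l hl
      rw [hfix l]
      refine Finset.sum_eq_zero fun k _ => ?_
      by_cases h : N.head (Sum.inl k) = N.tail l
      · have hk := hrank k
        rw [h, hl] at hk
        rw [ih _ hk k rfl, mul_zero]
      · rw [N.β_eq_zero_of_head_ne_tail h, zero_mul]
  exact funext fun l => hzero _ l rfl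

/-- The supremum defining the scale factor is attained as soon as all supplies are nonnegative. -/
theorem αgen_mem (δ : O ⊕ R → ℝ) (ρO : O → ℝ) (v : V)
    (hsupply : ∀ k ∈ N.Lout v, 0 ≤ N.Φin k (ρO k)) :
    N.αgen δ ρO v ∈ Set.Icc (0 : ℝ) 1 ∧
      ∀ k ∈ N.Lout v, N.αgen δ ρO v * ∑ j ∈ N.Lin v, N.β j k * δ j ≤ N.Φin k (ρO k) := by
  have hclosed : IsClosed {a : ℝ | a ∈ Set.Icc (0 : ℝ) 1 ∧
      ∀ k ∈ N.Lout v, a * ∑ j ∈ N.Lin v, N.β j k * δ j ≤ N.Φin k (ρO k)} := by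
    have hinter : IsClosed (Set.Icc (0 : ℝ) 1 ∩ ⋂ k ∈ N.Lout v,
        {a : ℝ | a * ∑ j ∈ N.Lin v, N.β j k * δ j ≤ N.Φin k (ρO k)}) :=
      isClosed_Icc.inter <| isClosed_iInter fun k => isClosed_iInter fun _ =>
        isClosed_le (by fun_prop) continuous_const
    convert hinter using 1
    ext a
    simp
  exact hclosed.csSup_mem ⟨0, by simp, fun k hk => by simpa using hsupply k hk⟩
    ⟨1, fun a ha => ha.1.2⟩

variable {N}

theorem memD.supply_nonneg {ρ : O ⊕ R → ℝ} (hρ : N.memD ρ) (k : O) :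
    0 ≤ N.Φin k (ρ (Sum.inl k)) :=
  N.Φin_nonneg k _ (hρ.2 k)

theorem memD.fout_le_demand {ρ : O ⊕ R → ℝ} (hρ : N.memD ρ) (l : O) :
    N.fout ρ (Sum.inl l) ≤ N.Φout (Sum.inl l) (ρ (Sum.inl l)) :=
  mul_le_of_le_one_left (N.Φout_nonneg l _ (hρ.2 l))
    (N.αgen_mem _ _ _ fun k _ => hρ.supply_nonneg k).1.2

theorem memD.fin_le_supply {ρ : O ⊕ R → ℝ} (hρ : N.memD ρ) (l : O) :
    N.fin ρ l ≤ N.Φin l (ρ (Sum.inl l)) := by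
  refine le_of_eq_of_le ?_ ((N.αgen_mem (N.demand ρ) (fun k => ρ (Sum.inl k)) (N.tail l)
    fun k _ => hρ.supply_nonneg k).2 l (by simp [Lout]))
  rw [fin, finGen, Finset.mul_sum]
  refine Finset.sum_congr rfl fun j hj => ?_
  have hhead : N.head j = N.tail l := by simpa [Lin] using hj
  rw [foutGen, hhead]
  ring

theorem IsEquilibrium.fout_eq {d : R → ℝ} {ρ : O ⊕ R → ℝ} (h : N.IsEquilibrium d ρ) :
    (fun l : O => N.fout ρ (Sum.inl l)) =
      (1 - N.Amat)⁻¹.mulVec (N.Bmat.mulVec d) := by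
  have hbalance : (1 - N.Amat).mulVec (fun l : O => N.fout ρ (Sum.inl l)) =
      N.Bmat.mulVec d := by
    rw [Matrix.sub_mulVec, Matrix.one_mulVec, sub_eq_iff_eq_add']
    funext l
    have hfin : N.fin ρ l = ∑ j, N.β j l * N.fout ρ j := N.sum_Lin_β_mul (N.fout ρ) l
    rw [h.2.2 l, hfin, Fintype.sum_sum_type]
    simp [Matrix.mulVec, dotProduct, Amat, Bmat, h.2.1]
  rw [← hbalance, Matrix.mulVec_mulVec,
    Matrix.nonsing_inv_mul _ ((Matrix.isUnit_iff_isUnit_det _).mp N.isUnit_one_sub_Amat),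
    Matrix.one_mulVec]

theorem IsEquilibrium.fout_le_crit {d : R → ℝ} {ρ : O ⊕ R → ℝ} (h : N.IsEquilibrium d ρ)
    {l : O} {x : ℝ} (hx : N.IsCrit l x) : N.fout ρ (Sum.inl l) ≤ N.Φin l x := by
  rcases le_total (ρ (Sum.inl l)) x with hle | hle
  · calc N.fout ρ (Sum.inl l) ≤ N.Φout (Sum.inl l) (ρ (Sum.inl l)) := h.1.fout_le_demand l
      _ ≤ N.Φout (Sum.inl l) x := (N.Φout_strictMono l).monotoneOn (h.1.2 l) hx.1 hle
      _ = N.Φin l x := hx.2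
  · calc N.fout ρ (Sum.inl l) = N.fin ρ l := h.2.2 l
      _ ≤ N.Φin l (ρ (Sum.inl l)) := h.1.fin_le_supply l
      _ ≤ N.Φin l x := (N.Φin_strictAnti l).antitoneOn hx.1 (h.1.2 l) hle

end TrafficNetwork

/-- **Proposition 2, uniqueness and necessity.** If the constant
input flow `{d_l}` is feasible, then the equilibrium flow on the ordinary
links is unique, given by `fe_O = (I − A)⁻¹ B d`, and it satisfies
`(I − A)⁻¹ B d ≤ Φcrit` componentwise. -/
theorem stmt3 {V O R : Type} [Fintype V] [Fintype O] [Fintype R]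
    [DecidableEq V] [DecidableEq O] [DecidableEq R]
    (N : TrafficNetwork V O R)
    (d : R → ℝ) (hd : ∀ r, 0 ≤ d r)
    (ρcrit : O → ℝ) (hcrit : ∀ l, N.IsCrit l (ρcrit l))
    (hfeas : N.Feasible d) :
    (∀ ρe : O ⊕ R → ℝ, N.IsEquilibrium d ρe →
      (fun l : O => N.fout ρe (Sum.inl l)) = (1 - N.Amat)⁻¹.mulVec (N.Bmat.mulVec d)) ∧
    (∀ l : O, ((1 - N.Amat)⁻¹.mulVec (N.Bmat.mulVec d)) l ≤ N.Φin l (ρcrit l)) := by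
  refine ⟨fun ρe he => he.fout_eq, fun l => ?_⟩
  obtain ⟨ρe, he⟩ := hfeas
  rw [← he.fout_eq]
  exact he.fout_le_crit (hcrit l)
end

section
/- Let s : [0,∞) → ℝ and g : ℝ → ℝ be differentiable and monotone nondecreasing, and let x : [0,∞) → ℝ be differentiable with ẋ(t) = s(t) − g(x(t)) for all t ≥ 0. If ẋ(0) ≥ 0, then ẋ(t) ≥ 0 for all t ≥ 0. (Auxiliary claim in the proof of Proposition 4) -/
/-- Let `s : [0,∞) → ℝ` and `g : ℝ → ℝ` be differentiable and
monotone nondecreasing, and let `x : [0,∞) → ℝ` be differentiable with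
`ẋ(t) = s(t) − g(x(t))` for all `t ≥ 0`.  If `ẋ(0) ≥ 0`, then `ẋ(t) ≥ 0` for
all `t ≥ 0`. -/
theorem stmt10 (s g x : ℝ → ℝ)
    (hs_diff : Differentiable ℝ s) (hs_mono : Monotone s)
    (hg_diff : Differentiable ℝ g) (hg_mono : Monotone g)
    (hode : ∀ t : ℝ, 0 ≤ t → HasDerivAt x (s t - g (x t)) t)
    (h0 : 0 ≤ deriv x 0) :
    ∀ t : ℝ, 0 ≤ t → 0 ≤ deriv x t := by
  intro t ht
  rw [(hode 0 le_rfl).deriv] at h0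
  rw [(hode t ht).deriv]
  by_contra! hneg
  have hx_cont : ContinuousOn x (Set.Icc 0 t) := fun u hu =>
    (hode u hu.1).continuousAt.continuousWithinAt
  have hy_cont : ContinuousOn (fun u => s u - g (x u)) (Set.Icc 0 t) :=
    hs_diff.continuous.continuousOn.sub (hg_diff.continuous.comp_continuousOn hx_cont)
  -- The last time before `t` at which the derivative is nonnegative.
  obtain ⟨a, ⟨⟨ha0, hat⟩, hya⟩, ha_max⟩ :=
    (isCompact_Icc.of_isClosed_subset
      (hy_cont.preimage_isClosed_of_isClosed isClosed_Icc isClosed_Ici)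
      Set.inter_subset_left).exists_isGreatest ⟨0, ⟨le_rfl, ht⟩, h0⟩
  have hx_anti : AntitoneOn x (Set.Icc a t) := by
    refine antitoneOn_of_deriv_nonpos (convex_Icc a t)
      (hx_cont.mono (Set.Icc_subset_Icc_left ha0)) ?_ ?_
    all_goals
      intro u hu
      rw [interior_Icc] at hu
      have hderiv := hode u (ha0.trans hu.1.le)
    · exact hderiv.differentiableAt.differentiableWithinAt
    · rw [hderiv.deriv]
      by_contra! hpos
      exact hu.1.not_ge (ha_max ⟨⟨ha0.trans hu.1.le, hu.2.le⟩, hpos.le⟩)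
  have hgx := hg_mono (hx_anti (Set.left_mem_Icc.2 hat) (Set.right_mem_Icc.2 hat) hat)
  have hya' : 0 ≤ s a - g (x a) := hya
  linarith [hs_mono hat]
end

section
/- If the traffic network graph is a polytree (a directed acyclic graph whose underlying undirected graph has exactly one path between any two vertices), then for any constant infeasible input flow {d_l}_{l∈R} the generalized equilibrium flow {fe_l}_{l∈L} is unique. (Proposition 6) -/
open scoped BigOperators ENNReal

/-- The traffic network graph is a polytree: the underlying undirected graph
(on junctions, with ordinary links as edges) is a tree — equivalently, there is
exactly one undirected path between any two junctions — and there are no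
parallel links. -/
def TrafficNetwork.IsPolytree {V O R : Type} [Fintype V] [Fintype O] [Fintype R]
    [DecidableEq V] [DecidableEq O] [DecidableEq R]
    (N : TrafficNetwork V O R) : Prop :=
  (SimpleGraph.fromRel (fun a b : V =>
      ∃ l : O, N.tail l = a ∧ N.head (Sum.inl l) = b)).IsTree ∧
  ∀ l k : O, N.tail l = N.tail k → N.head (Sum.inl l) = N.head (Sum.inl k) → l = k

/-- In a finite acyclic graph there is no nonempty set of darts in which every dart can be
continued by another one without backtracking. -/
theorem SimpleGraph.IsAcyclic.not_dart_of_nonbacktracking {V : Type*} [Fintype V]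
    {G : SimpleGraph V} (hG : G.IsAcyclic) (S : V → V → Prop)
    (hadj : ∀ u v, S u v → G.Adj u v)
    (hstep : ∀ u v, S u v → ∃ w, S v w ∧ w ≠ u) (u v : V) : ¬ S u v := by
  intro huv
  have key : ∀ n : ℕ, ∃ (a b x : V) (h : G.Adj b a) (q : G.Walk a x), S a b ∧
      List.IsChain (· ≠ ·) (SimpleGraph.Walk.cons h q).edges ∧ q.length = n := by
    intro n
    induction n with
    | zero => exact ⟨u, v, u, (hadj _ _ huv).symm, .nil, huv, by simp, rfl⟩
    | succ n ih =>
      obtain ⟨a, b, x, h, q, hS, hchain, hlen⟩ := ih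
      obtain ⟨w, hw, hne⟩ := hstep a b hS
      refine ⟨b, w, x, (hadj _ _ hw).symm, .cons h q, hw, ?_, by simp [hlen]⟩
      rw [SimpleGraph.Walk.edges_cons] at hchain ⊢
      rw [SimpleGraph.Walk.edges_cons, List.isChain_cons_cons]
      refine ⟨fun heq => ?_, hchain⟩
      rcases Sym2.eq_iff.1 heq with ⟨h1, h2⟩ | ⟨h1, -⟩
      · exact (hadj _ _ hw).ne h1.symm
      · exact hne h1
  obtain ⟨a, b, x, h, q, -, hchain, hlen⟩ := key (Fintype.card V)
  have := ((hG.isPath_iff_isChain _).2 hchain).length_lt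
  simp [hlen] at this

namespace TrafficNetwork

variable {V O R : Type} [Fintype V] [Fintype O] [Fintype R]
  [DecidableEq V] [DecidableEq O] [DecidableEq R] {N : TrafficNetwork V O R}

theorem αgen_isGreatest {δ : O ⊕ R → ℝ} {ρO : O → ℝ} (hs : ∀ k, 0 ≤ N.Φin k (ρO k)) (v : V) :
    IsGreatest {a : ℝ | a ∈ Set.Icc (0 : ℝ) 1 ∧
      ∀ k ∈ N.Lout v, a * ∑ j ∈ N.Lin v, N.β j k * δ j ≤ N.Φin k (ρO k)} (N.αgen δ ρO v) := by
  have hclosed : IsClosed {a : ℝ | a ∈ Set.Icc (0 : ℝ) 1 ∧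
      ∀ k ∈ N.Lout v, a * ∑ j ∈ N.Lin v, N.β j k * δ j ≤ N.Φin k (ρO k)} := by
    have heq : {a : ℝ | a ∈ Set.Icc (0 : ℝ) 1 ∧
        ∀ k ∈ N.Lout v, a * ∑ j ∈ N.Lin v, N.β j k * δ j ≤ N.Φin k (ρO k)} =
        Set.Icc 0 1 ∩ ⋂ k ∈ N.Lout v,
          {a : ℝ | a * ∑ j ∈ N.Lin v, N.β j k * δ j ≤ N.Φin k (ρO k)} := by
      ext a
      simp
    rw [heq]
    exact isClosed_Icc.inter (isClosed_biInter fun k _ =>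
      isClosed_le (by fun_prop) continuous_const)
  have hbdd : BddAbove {a : ℝ | a ∈ Set.Icc (0 : ℝ) 1 ∧
      ∀ k ∈ N.Lout v, a * ∑ j ∈ N.Lin v, N.β j k * δ j ≤ N.Φin k (ρO k)} :=
    ⟨1, fun _ ha => ha.1.2⟩
  exact ⟨hclosed.csSup_mem ⟨0, by simp, fun k _ => by simpa using hs k⟩ hbdd,
    fun _ ha => le_csSup hbdd ha⟩

/-- If the scale factor at a junction is below `1`, some outgoing link is a bottleneck. -/
theorem exists_bottleneck {δ : O ⊕ R → ℝ} {ρO : O → ℝ} (hs : ∀ k, 0 ≤ N.Φin k (ρO k)) {v : V}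
    (hα : N.αgen δ ρO v < 1) :
    ∃ k ∈ N.Lout v, N.αgen δ ρO v * ∑ j ∈ N.Lin v, N.β j k * δ j = N.Φin k (ρO k) := by
  obtain ⟨⟨⟨h0, -⟩, hle⟩, hmax⟩ := αgen_isGreatest (δ := δ) hs v
  by_contra! hne
  have hev : ∀ᶠ a in nhds (N.αgen δ ρO v),
      ∀ k ∈ N.Lout v, a * ∑ j ∈ N.Lin v, N.β j k * δ j < N.Φin k (ρO k) := by
    rw [Filter.eventually_all_finset]
    intro k hk
    exact (continuous_id.mul continuous_const).continuousAt.eventually_lt continuousAt_const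
      (lt_of_le_of_ne (hle k hk) (hne k hk))
  have hlt : ∀ᶠ a in nhds (N.αgen δ ρO v), a < 1 := eventually_lt_nhds hα
  obtain ⟨a, ⟨ha1, ha2⟩, ha3⟩ :=
    (((hev.and hlt).filter_mono nhdsWithin_le_nhds).and
      (self_mem_nhdsWithin (s := Set.Ioi (N.αgen δ ρO v)))).exists
  exact absurd (hmax ⟨⟨h0.trans (le_of_lt ha3), ha2.le⟩, fun k hk => (ha1 k hk).le⟩)
    (not_le.2 ha3)

theorem δext_inr_nonneg (ρO : O → ℝ) (ρR : R → ℝ≥0∞) (r : R) :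
    0 ≤ N.δext ρO ρR (Sum.inr r) := by
  simp only [δext, Sum.elim_inr]
  split_ifs
  · exact (N.ΦoutR_nonneg r 0 (by simp)).trans
      (le_csSup (N.ΦoutR_bddAbove r) (Set.mem_image_of_mem _ (by simp)))
  · exact N.ΦoutR_nonneg r _ (by simp)

theorem δext_inr_le (ρO ρO' : O → ℝ) {ρR : R → ℝ≥0∞} (ρR' : R → ℝ≥0∞) {r : R}
    (hr : ρR r = ⊤) : N.δext ρO' ρR' (Sum.inr r) ≤ N.δext ρO ρR (Sum.inr r) := by
  simp only [δext, Sum.elim_inr, hr, if_true]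
  split_ifs
  · exact le_rfl
  · exact le_csSup (N.ΦoutR_bddAbove r) (Set.mem_image_of_mem _ (by simp))

namespace IsGenEquilibrium

variable {d : R → ℝ} {ρO ρO' : O → ℝ} {ρR ρR' : R → ℝ≥0∞}

theorem supply_nonneg (h : N.IsGenEquilibrium d ρO ρR) (k : O) : 0 ≤ N.Φin k (ρO k) :=
  N.Φin_nonneg k _ (h.1 k)

theorem δext_nonneg (h : N.IsGenEquilibrium d ρO ρR) (l : O ⊕ R) : 0 ≤ N.δext ρO ρR l := by
  rcases l with l | r
  · exact N.Φout_nonneg l _ (h.1 l)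
  · exact δext_inr_nonneg ρO ρR r

theorem αgen_nonneg (h : N.IsGenEquilibrium d ρO ρR) (v : V) :
    0 ≤ N.αgen (N.δext ρO ρR) ρO v :=
  (αgen_isGreatest h.supply_nonneg v).1.1.1

theorem αgen_le_one (h : N.IsGenEquilibrium d ρO ρR) (v : V) :
    N.αgen (N.δext ρO ρR) ρO v ≤ 1 :=
  (αgen_isGreatest h.supply_nonneg v).1.1.2

theorem foutExt_eq_sum (h : N.IsGenEquilibrium d ρO ρR) (k : O) :
    N.foutExt ρO ρR (Sum.inl k) =
      ∑ j ∈ N.Lin (N.tail k), N.β j k * N.foutExt ρO ρR j :=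
  h.2.1 k

theorem foutExt_eq_αgen_mul (h : N.IsGenEquilibrium d ρO ρR) (k : O) :
    N.foutExt ρO ρR (Sum.inl k) = N.αgen (N.δext ρO ρR) ρO (N.tail k) *
      ∑ j ∈ N.Lin (N.tail k), N.β j k * N.δext ρO ρR j := by
  rw [h.foutExt_eq_sum, Finset.mul_sum]
  refine Finset.sum_congr rfl fun j hj => ?_
  have hj' : N.head j = N.tail k := (Finset.mem_filter.1 hj).2
  rw [foutExt, foutGen, hj']
  ring

theorem foutExt_le_supply (h : N.IsGenEquilibrium d ρO ρR) (k : O) :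
    N.foutExt ρO ρR (Sum.inl k) ≤ N.Φin k (ρO k) := by
  rw [h.foutExt_eq_αgen_mul]
  exact (αgen_isGreatest h.supply_nonneg _).1.2 k (by simp [Lout])

theorem exists_foutExt_eq_supply (h : N.IsGenEquilibrium d ρO ρR) {v : V}
    (hα : N.αgen (N.δext ρO ρR) ρO v < 1) :
    ∃ k, N.tail k = v ∧ N.foutExt ρO ρR (Sum.inl k) = N.Φin k (ρO k) := by
  obtain ⟨k, hk, heq⟩ := exists_bottleneck h.supply_nonneg hα
  have hk' : N.tail k = v := (Finset.mem_filter.1 hk).2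
  subst hk'
  exact ⟨k, rfl, (h.foutExt_eq_αgen_mul k).trans heq⟩

/-- A link with smaller outflow but larger demand has a smaller scale factor at its head. -/
theorem αgen_lt (h : N.IsGenEquilibrium d ρO ρR) (h' : N.IsGenEquilibrium d ρO' ρR')
    {l : O ⊕ R} (hlt : N.foutExt ρO ρR l < N.foutExt ρO' ρR' l)
    (hδ : N.δext ρO' ρR' l ≤ N.δext ρO ρR l) :
    N.αgen (N.δext ρO ρR) ρO (N.head l) < N.αgen (N.δext ρO' ρR') ρO' (N.head l) := by
  by_contra! hle
  exact absurd hlt (not_lt.2 (mul_le_mul hle hδ (h'.δext_nonneg l) (h.αgen_nonneg _)))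

theorem onramp_αgen_lt (h : N.IsGenEquilibrium d ρO ρR) (h' : N.IsGenEquilibrium d ρO' ρR')
    {r : R} (hlt : N.foutExt ρO ρR (Sum.inr r) < N.foutExt ρO' ρR' (Sum.inr r)) :
    N.αgen (N.δext ρO ρR) ρO (N.head (Sum.inr r)) <
      N.αgen (N.δext ρO' ρR') ρO' (N.head (Sum.inr r)) := by
  refine h.αgen_lt h' hlt (δext_inr_le _ _ _ ?_)
  rcases h.2.2 r with heq | ⟨-, htop⟩
  · rcases h'.2.2 r with heq' | ⟨hlt', -⟩ <;> linarith
  · exact htop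

end IsGenEquilibrium

/-- Link `k` carries less flow in the first state, and the scale factor at its head is smaller. -/
def Blocked (N : TrafficNetwork V O R) (ρO : O → ℝ) (ρR : R → ℝ≥0∞) (ρO' : O → ℝ)
    (ρR' : R → ℝ≥0∞) (k : O) : Prop :=
  N.foutExt ρO ρR (Sum.inl k) < N.foutExt ρO' ρR' (Sum.inl k) ∧
    N.αgen (N.δext ρO ρR) ρO (N.head (Sum.inl k)) <
      N.αgen (N.δext ρO' ρR') ρO' (N.head (Sum.inl k))

/-- Link `k` carries less flow in the first state, and does not exhaust its supply there. -/
def Starved (N : TrafficNetwork V O R) (ρO : O → ℝ) (ρR : R → ℝ≥0∞) (ρO' : O → ℝ)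
    (ρR' : R → ℝ≥0∞) (k : O) : Prop :=
  N.foutExt ρO ρR (Sum.inl k) < N.foutExt ρO' ρR' (Sum.inl k) ∧
    N.foutExt ρO ρR (Sum.inl k) < N.Φin k (ρO k)

namespace IsGenEquilibrium

variable {d : R → ℝ} {ρO ρO' : O → ℝ} {ρR ρR' : R → ℝ≥0∞}

/-- An incoming link with smaller flow at a junction whose scale factor is not smaller is an
ordinary link that does not exhaust its supply. -/
theorem exists_starved (h : N.IsGenEquilibrium d ρO ρR) (h' : N.IsGenEquilibrium d ρO' ρR')
    {l : O ⊕ R} (hlt : N.foutExt ρO ρR l < N.foutExt ρO' ρR' l)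
    (hα : N.αgen (N.δext ρO' ρR') ρO' (N.head l) ≤ N.αgen (N.δext ρO ρR) ρO (N.head l)) :
    ∃ j, l = Sum.inl j ∧ N.Starved ρO ρR ρO' ρR' j := by
  rcases l with j | r
  · refine ⟨j, rfl, hlt, ?_⟩
    have hδ : N.δext ρO ρR (Sum.inl j) < N.δext ρO' ρR' (Sum.inl j) := by
      by_contra! hle
      exact absurd (h.αgen_lt h' hlt hle) (not_lt.2 hα)
    have hρ : ρO j < ρO' j := ((N.Φout_strictMono j).lt_iff_lt (h.1 j) (h'.1 j)).1 hδ
    have hs := N.Φin_strictAnti j (h.1 j) (h'.1 j) hρ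
    have := h'.foutExt_le_supply j
    linarith
  · exact absurd (h.onramp_αgen_lt h' hlt) (not_lt.2 hα)

/-- At a junction with smaller scale factor and an incoming link carrying less flow, there is a
bottleneck `k`; either `k` is itself blocked or some incoming link is starved in the other state. -/
theorem exists_blocked_or_starved (h : N.IsGenEquilibrium d ρO ρR)
    (h' : N.IsGenEquilibrium d ρO' ρR') {l : O ⊕ R}
    (hlt : N.foutExt ρO ρR l < N.foutExt ρO' ρR' l)
    (hα : N.αgen (N.δext ρO ρR) ρO (N.head l) < N.αgen (N.δext ρO' ρR') ρO' (N.head l)) :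
    (∃ k, N.tail k = N.head l ∧ N.foutExt ρO ρR (Sum.inl k) = N.Φin k (ρO k) ∧
      N.Blocked ρO ρR ρO' ρR' k) ∨
    ∃ j, N.head (Sum.inl j) = N.head l ∧ N.Starved ρO' ρR' ρO ρR j := by
  obtain ⟨k, hk, htight⟩ := h.exists_foutExt_eq_supply (hα.trans_le (h'.αgen_le_one _))
  by_cases hf : N.foutExt ρO ρR (Sum.inl k) < N.foutExt ρO' ρR' (Sum.inl k)
  · refine .inl ⟨k, hk, htight, hf, h.αgen_lt h' hf ?_⟩
    have hs : N.Φin k (ρO k) < N.Φin k (ρO' k) := by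
      have := h'.foutExt_le_supply k
      linarith
    have hρ : ρO' k < ρO k := ((N.Φin_strictAnti k).lt_iff_gt (h.1 k) (h'.1 k)).1 hs
    exact (N.Φout_strictMono k (h'.1 k) (h.1 k) hρ).le
  · right
    rw [h.foutExt_eq_sum, h'.foutExt_eq_sum, not_lt, hk] at hf
    have hex : ∃ j ∈ N.Lin (N.head l), N.foutExt ρO' ρR' j < N.foutExt ρO ρR j := by
      by_contra! hle
      refine absurd hf (not_le.2 (Finset.sum_lt_sum
        (fun j hj => mul_le_mul_of_nonneg_left (hle j hj) (N.β_nonneg j k))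
        ⟨l, by simp [Lin], mul_lt_mul_of_pos_left hlt (N.β_pos l k hk.symm)⟩))
    obtain ⟨j, hj, hjlt⟩ := hex
    have hj' : N.head j = N.head l := (Finset.mem_filter.1 hj).2
    obtain ⟨i, rfl, hi⟩ := h'.exists_starved h hjlt (by rw [hj']; exact hα.le)
    exact ⟨i, hj', hi⟩

/-- Upstream of a starved link there is a starved link, or a bottleneck at its tail. -/
theorem exists_of_starved (h : N.IsGenEquilibrium d ρO ρR)
    (h' : N.IsGenEquilibrium d ρO' ρR') {j : O} (hj : N.Starved ρO ρR ρO' ρR' j) :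
    (∃ k, N.tail k = N.tail j ∧ k ≠ j ∧ N.Blocked ρO ρR ρO' ρR' k) ∨
    ∃ i, N.head (Sum.inl i) = N.tail j ∧
      (N.Starved ρO ρR ρO' ρR' i ∨ N.Starved ρO' ρR' ρO ρR i) := by
  obtain ⟨i, hi, hilt⟩ : ∃ i ∈ N.Lin (N.tail j), N.foutExt ρO ρR i < N.foutExt ρO' ρR' i := by
    by_contra! hle
    have := hj.1
    rw [h.foutExt_eq_sum, h'.foutExt_eq_sum] at this
    exact absurd this (not_lt.2 (Finset.sum_le_sum fun i hi =>
      mul_le_mul_of_nonneg_left (hle i hi) (N.β_nonneg i j)))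
  have hi' : N.head i = N.tail j := (Finset.mem_filter.1 hi).2
  rcases lt_or_ge (N.αgen (N.δext ρO ρR) ρO (N.head i))
    (N.αgen (N.δext ρO' ρR') ρO' (N.head i)) with hα | hα
  · rcases h.exists_blocked_or_starved h' hilt hα with ⟨k, hk, htight, hb⟩ | ⟨m, hm, hs⟩
    · refine .inl ⟨k, hk.trans hi', ?_, hb⟩
      rintro rfl
      exact hj.2.ne htight
    · exact .inr ⟨m, hm.trans hi', .inr hs⟩
  · obtain ⟨m, rfl, hm⟩ := h.exists_starved h' hilt hα
    exact .inr ⟨m, hi', .inl hm⟩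

/-- If the flows of two generalized equilibria differ on some link, they differ on an onramp. -/
theorem exists_onramp_ne (h : N.IsGenEquilibrium d ρO ρR) (h' : N.IsGenEquilibrium d ρO' ρR')
    {l : O ⊕ R} (hne : N.foutExt ρO ρR l ≠ N.foutExt ρO' ρR' l) :
    ∃ r, N.foutExt ρO ρR (Sum.inr r) ≠ N.foutExt ρO' ρR' (Sum.inr r) := by
  obtain ⟨rank, hrank⟩ := N.acyclic
  induction hn : rank (N.head l) using Nat.strong_induction_on generalizing l with
  | _ n ih =>
    rcases l with k | r
    · have hex : ∃ j ∈ N.Lin (N.tail k), N.foutExt ρO ρR j ≠ N.foutExt ρO' ρR' j := by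
        by_contra! hall
        refine hne ?_
        rw [h.foutExt_eq_sum, h'.foutExt_eq_sum]
        exact Finset.sum_congr rfl fun j hj => by rw [hall j hj]
      obtain ⟨j, hj, hjne⟩ := hex
      have hj' : N.head j = N.tail k := (Finset.mem_filter.1 hj).2
      exact ih _ (by rw [← hn, hj']; exact hrank k) hjne rfl
    · exact ⟨r, hne⟩

end IsGenEquilibrium

/-- The generalized equilibrium flow on a polytree is unique. -/
theorem IsPolytree.foutExt_eq (hpoly : N.IsPolytree) {d : R → ℝ} {ρO ρO' : O → ℝ}
    {ρR ρR' : R → ℝ≥0∞} (h : N.IsGenEquilibrium d ρO ρR) (h' : N.IsGenEquilibrium d ρO' ρR')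
    (l : O ⊕ R) : N.foutExt ρO ρR l = N.foutExt ρO' ρR' l := by
  obtain ⟨htree, hpar⟩ := hpoly
  obtain ⟨rank, hrank⟩ := N.acyclic
  let B : O → Prop := fun k => N.Blocked ρO ρR ρO' ρR' k ∨ N.Blocked ρO' ρR' ρO ρR k
  let T : O → Prop := fun k => N.Starved ρO ρR ρO' ρR' k ∨ N.Starved ρO' ρR' ρO ρR k
  let S : V → V → Prop := fun u v =>
    (∃ k, B k ∧ N.tail k = u ∧ N.head (Sum.inl k) = v) ∨
    (∃ k, T k ∧ N.head (Sum.inl k) = u ∧ N.tail k = v)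
  have hblocked : ∀ k, B k → (∃ m, B m ∧ N.tail m = N.head (Sum.inl k)) ∨
      ∃ m, T m ∧ N.head (Sum.inl m) = N.head (Sum.inl k) ∧ m ≠ k := by
    rintro k (hk | hk)
    · rcases h.exists_blocked_or_starved h' hk.1 hk.2 with ⟨m, hm, -, hb⟩ | ⟨m, hm, hs⟩
      · exact .inl ⟨m, .inl hb, hm⟩
      · exact .inr ⟨m, .inr hs, hm, by rintro rfl; exact hs.1.not_gt hk.1⟩
    · rcases h'.exists_blocked_or_starved h hk.1 hk.2 with ⟨m, hm, -, hb⟩ | ⟨m, hm, hs⟩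
      · exact .inl ⟨m, .inr hb, hm⟩
      · exact .inr ⟨m, .inl hs, hm, by rintro rfl; exact hs.1.not_gt hk.1⟩
  have hstarved : ∀ k, T k → (∃ m, B m ∧ N.tail m = N.tail k ∧ m ≠ k) ∨
      ∃ m, T m ∧ N.head (Sum.inl m) = N.tail k := by
    rintro k (hk | hk)
    · rcases h.exists_of_starved h' hk with ⟨m, hm, hne, hb⟩ | ⟨m, hm, hs⟩
      · exact .inl ⟨m, .inl hb, hm, hne⟩
      · exact .inr ⟨m, hs, hm⟩
    · rcases h'.exists_of_starved h hk with ⟨m, hm, hne, hb⟩ | ⟨m, hm, hs⟩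
      · exact .inl ⟨m, .inr hb, hm, hne⟩
      · exact .inr ⟨m, hs.symm, hm⟩
  have hnone : ∀ u v, ¬ S u v := by
    refine htree.isAcyclic.not_dart_of_nonbacktracking S ?_ ?_
    · rintro u v (⟨k, -, rfl, rfl⟩ | ⟨k, -, rfl, rfl⟩) <;> rw [SimpleGraph.fromRel_adj]
      · exact ⟨fun heq => (hrank k).ne (congrArg rank heq), .inl ⟨k, rfl, rfl⟩⟩
      · exact ⟨fun heq => (hrank k).ne' (congrArg rank heq), .inr ⟨k, rfl, rfl⟩⟩
    · rintro u v (⟨k, hk, rfl, rfl⟩ | ⟨k, hk, rfl, rfl⟩)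
      · rcases hblocked k hk with ⟨m, hm, heq⟩ | ⟨m, hm, heq, hne⟩
        · refine ⟨_, .inl ⟨m, hm, heq, rfl⟩, fun hback => ?_⟩
          have h1 := hrank k
          have h2 := hrank m
          rw [heq, hback] at h2
          omega
        · exact ⟨_, .inr ⟨m, hm, heq, rfl⟩, fun hback => hne (hpar m k hback heq)⟩
      · rcases hstarved k hk with ⟨m, hm, heq, hne⟩ | ⟨m, hm, heq⟩
        · exact ⟨_, .inl ⟨m, hm, heq, rfl⟩, fun hback => hne (hpar m k heq hback)⟩
        · refine ⟨_, .inr ⟨m, hm, heq, rfl⟩, fun hback => ?_⟩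
          have h1 := hrank k
          have h2 := hrank m
          rw [heq, hback] at h2
          omega
  by_contra hne
  obtain ⟨r, hr⟩ := h.exists_onramp_ne h' hne
  rcases hr.lt_or_gt with hlt | hlt
  · rcases h.exists_blocked_or_starved h' hlt (h.onramp_αgen_lt h' hlt) with
      ⟨m, -, -, hb⟩ | ⟨m, -, hs⟩
    · exact hnone _ _ (.inl ⟨m, .inl hb, rfl, rfl⟩)
    · exact hnone _ _ (.inr ⟨m, .inr hs, rfl, rfl⟩)
  · rcases h'.exists_blocked_or_starved h hlt (h'.onramp_αgen_lt h hlt) with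
      ⟨m, -, -, hb⟩ | ⟨m, -, hs⟩
    · exact hnone _ _ (.inl ⟨m, .inr hb, rfl, rfl⟩)
    · exact hnone _ _ (.inr ⟨m, .inl hs, rfl, rfl⟩)

end TrafficNetwork

/-- **Proposition 6.** If the traffic network graph is a
polytree (a directed acyclic graph whose underlying undirected graph has
exactly one path between any two vertices), then for any constant infeasible
input flow `{d_l}` the generalized equilibrium flow `{fe_l}` is unique. -/
theorem stmt12 {V O R : Type} [Fintype V] [Fintype O] [Fintype R]
    [DecidableEq V] [DecidableEq O] [DecidableEq R]
    (N : TrafficNetwork V O R) (hpoly : N.IsPolytree)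
    (d : R → ℝ) (hd : ∀ r, 0 ≤ d r) (hinfeas : ¬ N.Feasible d) :
    ∀ (ρO ρO' : O → ℝ) (ρR ρR' : R → ℝ≥0∞),
      N.IsGenEquilibrium d ρO ρR → N.IsGenEquilibrium d ρO' ρR' →
      ∀ l : O ⊕ R, N.foutExt ρO ρR l = N.foutExt ρO' ρR' l := by
  intro ρO ρO' ρR ρR' h h' l
  exact hpoly.foutExt_eq h h' l
end

section
/- Consider a traffic network with constant input flows satisfying |L^out_v| ≤ 1 for every junction v and, for every v, the offramp fraction γ_l := 1 − Σ_{k∈L^out_{σ(l)}} β_{lk} equals a common value Γ_v for all l ∈ L^in_v. Define weights w_l := 1 − Γ_{σ(l)} if Γ_{σ(l)} < 1 and w_l := 1 otherwise, and W_l := w_{l_1}·…·w_{l_{n_l}}, where l = l_1, l_2, …, l_{n_l} is the unique directed path from l to the sink junction; let W := diag(W_1,…,W_{|L|}). Then at every density ρ in the interior of D at which the vector field F is differentiable, the matrix W·(∂F/∂ρ)(ρ) is a compartmental matrix: its off-diagonal entries are nonnegative and all its column sums are nonpositive. (Lemma 2) -/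
open scoped BigOperators ENNReal

namespace TrafficNetwork

variable {V O R : Type} [Fintype V] [Fintype O] [Fintype R]
  [DecidableEq V] [DecidableEq O] [DecidableEq R]

/-- offramp fraction `γ_l = 1 − Σ_{k ∈ L^out_{σ(l)}} β_{lk}` -/
noncomputable def γfrac (N : TrafficNetwork V O R) (l : O ⊕ R) : ℝ :=
  1 - ∑ k ∈ N.Lout (N.head l), N.β l k

/-- the weight `w_l := 1 − Γ_{σ(l)}` if `Γ_{σ(l)} < 1`, else `1` -/
noncomputable def wgt (N : TrafficNetwork V O R) (l : O ⊕ R) : ℝ :=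
  if N.γfrac l < 1 then 1 - N.γfrac l else 1

end TrafficNetwork

/-- A function that does not decrease from `x` along the ray in direction `v`, as long as the ray
stays in a neighbourhood `D` of `x`, has nonnegative directional derivative at `x`. -/
theorem HasFDerivAt.apply_nonneg_of_le_on_ray {E : Type*} [NormedAddCommGroup E] [NormedSpace ℝ E]
    {G : E → ℝ} {G' : E →L[ℝ] ℝ} {x v : E} {D : Set E} (hG : HasFDerivAt G G' x)
    (hx : x ∈ interior D) (hmono : ∀ t : ℝ, 0 ≤ t → x + t • v ∈ D → G x ≤ G (x + t • v)) :
    0 ≤ G' v := by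
  have hline : HasDerivAt (fun t : ℝ => G (x + t • v)) (G' v) 0 := by
    have h1 : HasDerivAt (fun t : ℝ => x + t • v) v 0 := by
      simpa using ((hasDerivAt_id (0 : ℝ)).smul_const v).const_add x
    have h2 : HasFDerivAt G G' (x + (0 : ℝ) • v) := by simpa using hG
    exact h2.comp_hasDerivAt (0 : ℝ) h1
  have hcont : Filter.Tendsto (fun t : ℝ => x + t • v) (nhds 0) (nhds x) := by
    have h : Continuous fun t : ℝ => x + t • v := by fun_prop
    simpa using h.tendsto 0
  have hD : ∀ᶠ t : ℝ in nhds 0, x + t • v ∈ D :=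
    hcont.eventually (mem_interior_iff_mem_nhds.mp hx)
  refine ge_of_tendsto hline.tendsto_slope_zero_right ?_
  filter_upwards [self_mem_nhdsWithin, hD.filter_mono nhdsWithin_le_nhds] with t ht htD
  have ht0 : (0 : ℝ) < t := ht
  have := hmono t ht0.le htD
  simp only [zero_add, zero_smul, add_zero, smul_eq_mul]
  exact mul_nonneg (inv_nonneg.mpr ht0.le) (sub_nonneg.mpr this)

/-- Scaling `S` by the largest admissible factor in `[0, 1]` truncates it at the bound `c`. -/
theorem sSup_scale_mul_eq_min {S c : ℝ} (hS : 0 ≤ S) (hc : 0 ≤ c) :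
    sSup {a : ℝ | a ∈ Set.Icc (0 : ℝ) 1 ∧ a * S ≤ c} * S = min S c := by
  rcases hS.eq_or_lt with rfl | hS
  · simp [hc]
  · have h : IsGreatest {a : ℝ | a ∈ Set.Icc (0 : ℝ) 1 ∧ a * S ≤ c} (min 1 (c / S)) := by
      refine ⟨⟨⟨le_min zero_le_one (by positivity), min_le_left _ _⟩, ?_⟩, ?_⟩
      · rw [← le_div_iff₀ hS]
        exact min_le_right _ _
      · rintro a ⟨⟨_, ha⟩, hac⟩
        exact le_min ha ((le_div_iff₀ hS).mpr hac)
    rw [h.csSup_eq, min_mul_of_nonneg _ _ hS.le, one_mul, div_mul_cancel₀ _ hS.ne']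

namespace TrafficNetwork

variable {V O R : Type} [Fintype V] [Fintype O] [Fintype R]
  [DecidableEq V] [DecidableEq O] [DecidableEq R] (N : TrafficNetwork V O R)

theorem mem_Lin {v : V} {l : O ⊕ R} : l ∈ N.Lin v ↔ N.head l = v := by simp [Lin]

theorem mem_Lout {v : V} {k : O} : k ∈ N.Lout v ↔ N.tail k = v := by simp [Lout]

theorem demand_nonneg {x : O ⊕ R → ℝ} (hx : N.memD x) (l : O ⊕ R) : 0 ≤ N.demand x l := by
  cases l with
  | inl l => exact N.Φout_nonneg l _ (hx.2 l)
  | inr r => exact N.ΦoutR_nonneg r _ (hx.1 r)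

theorem demand_mono {x y : O ⊕ R → ℝ} (hx : N.memD x) (hy : N.memD y) (hxy : x ≤ y)
    (l : O ⊕ R) : N.demand x l ≤ N.demand y l := by
  cases l with
  | inl l => exact (N.Φout_strictMono l).monotoneOn (hx.2 l) (hy.2 l) (hxy _)
  | inr r => exact (N.ΦoutR_strictMono r).monotoneOn (hx.1 r) (hy.1 r) (hxy _)

theorem αjunc_antitone {x y : O ⊕ R → ℝ} (hx : N.memD x) (hy : N.memD y) (hxy : x ≤ y)
    (v : V) : N.αjunc y v ≤ N.αjunc x v := by
  refine csSup_le_csSup ⟨1, fun a ha => ha.1.2⟩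
    ⟨0, ⟨le_rfl, zero_le_one⟩, fun k _ => by simpa using N.Φin_nonneg k _ (hy.2 k)⟩ ?_
  rintro a ⟨ha, hak⟩
  refine ⟨ha, fun k hk => ?_⟩
  calc a * ∑ j ∈ N.Lin v, N.β j k * N.demand x j
      ≤ a * ∑ j ∈ N.Lin v, N.β j k * N.demand y j :=
        mul_le_mul_of_nonneg_left (Finset.sum_le_sum fun j _ =>
          mul_le_mul_of_nonneg_left (N.demand_mono hx hy hxy j) (N.β_nonneg j k)) ha.1
    _ ≤ N.Φin k (y (Sum.inl k)) := hak k hk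
    _ ≤ N.Φin k (x (Sum.inl k)) :=
        (N.Φin_strictAnti k).antitoneOn (hx.2 k) (hy.2 k) (hxy _)

theorem fout_le_of_le {x y : O ⊕ R → ℝ} (hx : N.memD x) (hy : N.memD y) (hxy : x ≤ y)
    {l : O ⊕ R} (hl : x l = y l) : N.fout y l ≤ N.fout x l := by
  have h : N.demand y l = N.demand x l := by simp [demand, hl]
  change N.αjunc y (N.head l) * N.demand y l ≤ N.αjunc x (N.head l) * N.demand x l
  rw [h]
  exact mul_le_mul_of_nonneg_right (N.αjunc_antitone hx hy hxy _) (N.demand_nonneg hx l)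

theorem fin_eq_min (hmerge : ∀ v : V, (N.Lout v).card ≤ 1) {x : O ⊕ R → ℝ} (hx : N.memD x)
    (l : O) : N.fin x l =
      min (∑ j ∈ N.Lin (N.tail l), N.β j l * N.demand x j) (N.Φin l (x (Sum.inl l))) := by
  have hout : ∀ k, k ∈ N.Lout (N.tail l) ↔ k = l := fun k =>
    ⟨fun hk => Finset.card_le_one.mp (hmerge _) k hk l (N.mem_Lout.mpr rfl),
      fun hk => hk ▸ N.mem_Lout.mpr rfl⟩
  have hS : 0 ≤ ∑ j ∈ N.Lin (N.tail l), N.β j l * N.demand x j :=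
    Finset.sum_nonneg fun j _ => mul_nonneg (N.β_nonneg j l) (N.demand_nonneg hx j)
  rw [← sSup_scale_mul_eq_min hS (N.Φin_nonneg l _ (hx.2 l)), Finset.mul_sum]
  refine Finset.sum_congr rfl fun j hj => ?_
  simp only [foutGen, αgen, N.mem_Lin.mp hj, hout, forall_eq]
  ring

theorem fin_le_of_le (hmerge : ∀ v : V, (N.Lout v).card ≤ 1) {x y : O ⊕ R → ℝ}
    (hx : N.memD x) (hy : N.memD y) (hxy : x ≤ y) {l : O} (hl : x (Sum.inl l) = y (Sum.inl l)) :
    N.fin x l ≤ N.fin y l := by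
  rw [N.fin_eq_min hmerge hx, N.fin_eq_min hmerge hy, hl]
  exact min_le_min_right _ (Finset.sum_le_sum fun j _ =>
    mul_le_mul_of_nonneg_left (N.demand_mono hx hy hxy j) (N.β_nonneg j l))

/-- The vector field is of Kamke type: `F_l` is nondecreasing in the densities other than `ρ_l`. -/
theorem Fvec_le_of_le (hmerge : ∀ v : V, (N.Lout v).card ≤ 1) (d : R → ℝ) {x y : O ⊕ R → ℝ}
    (hx : N.memD x) (hy : N.memD y) (hxy : x ≤ y) {l : O ⊕ R} (hl : x l = y l) :
    N.Fvec d x l ≤ N.Fvec d y l := by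
  have hfout := N.fout_le_of_le hx hy hxy hl
  cases l with
  | inl l => exact sub_le_sub (N.fin_le_of_le hmerge hx hy hxy hl) hfout
  | inr r => exact sub_le_sub_left hfout _

theorem wgt_pos (l : O ⊕ R) : 0 < N.wgt l := by
  unfold wgt
  split_ifs with h
  · linarith
  · exact one_pos

theorem weight_nonneg {W : O ⊕ R → ℝ}
    (hW : ∀ l : O ⊕ R,
      (N.Lout (N.head l) = ∅ → W l = N.wgt l) ∧
      ∀ k ∈ N.Lout (N.head l), W l = N.wgt l * W (Sum.inl k)) (l : O ⊕ R) : 0 ≤ W l := by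
  obtain ⟨rank, hrank⟩ := N.acyclic
  by_contra! hl
  obtain ⟨m, hm, hmax⟩ := Finset.exists_max_image (Finset.univ.filter fun l => W l < 0)
    (fun l => rank (N.head l)) ⟨l, by simpa using hl⟩
  simp only [Finset.mem_filter, Finset.mem_univ, true_and] at hm hmax
  rcases (N.Lout (N.head m)).eq_empty_or_nonempty with h | ⟨k, hk⟩
  · rw [(hW m).1 h] at hm
    exact lt_asymm hm (N.wgt_pos m)
  · rw [(hW m).2 k hk] at hm
    have hkneg : W (Sum.inl k) < 0 := by
      by_contra! h
      exact hm.not_ge (mul_nonneg (N.wgt_pos m).le h)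
    have h1 := hmax _ hkneg
    have h2 := hrank k
    rw [N.mem_Lout.mp hk] at h2
    omega

theorem sum_β_mul_weight (hmerge : ∀ v : V, (N.Lout v).card ≤ 1) {W : O ⊕ R → ℝ}
    (hW : ∀ l : O ⊕ R, ∀ k ∈ N.Lout (N.head l), W l = N.wgt l * W (Sum.inl k)) (j : O ⊕ R) :
    ∑ k ∈ N.Lout (N.head j), N.β j k * W (Sum.inl k) =
      if N.Lout (N.head j) = ∅ then 0 else W j := by
  split_ifs with h
  · simp [h]
  · obtain ⟨k, hk⟩ := Finset.card_eq_one.mp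
      (le_antisymm (hmerge (N.head j)) (Finset.card_pos.mpr (Finset.nonempty_iff_ne_empty.mpr h)))
    have hkm : k ∈ N.Lout (N.head j) := by simp [hk]
    have hβ := N.β_pos j k (N.mem_Lout.mp hkm).symm
    have hw : N.wgt j = N.β j k := by simp [wgt, γfrac, hk, hβ]
    rw [hW j k hkm, hw, hk, Finset.sum_singleton]

/-- Only the links entering a sink junction contribute to the change of the weighted total mass. -/
theorem sum_weight_mul_Fvec (hmerge : ∀ v : V, (N.Lout v).card ≤ 1) (d : R → ℝ)
    {W : O ⊕ R → ℝ}
    (hW : ∀ l : O ⊕ R, ∀ k ∈ N.Lout (N.head l), W l = N.wgt l * W (Sum.inl k))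
    (x : O ⊕ R → ℝ) :
    ∑ l, W l * N.Fvec d x l =
      ∑ r, W (Sum.inr r) * d r -
        ∑ j, if N.Lout (N.head j) = ∅ then W j * N.fout x j else 0 := by
  have hswap : ∑ l : O, W (Sum.inl l) * N.fin x l =
      ∑ j, (∑ k ∈ N.Lout (N.head j), N.β j k * W (Sum.inl k)) * N.fout x j := by
    have h : ∀ l, N.fin x l = ∑ j ∈ N.Lin (N.tail l), N.β j l * N.fout x j := fun _ => rfl
    simp only [h, Finset.mul_sum, Finset.sum_mul]
    rw [Finset.sum_comm' (s' := fun j => N.Lout (N.head j)) (t' := Finset.univ)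
      (by simp [mem_Lin, mem_Lout, eq_comm])]
    exact Finset.sum_congr rfl fun j _ => Finset.sum_congr rfl fun k _ => by ring
  have hsplit : ∑ l, W l * N.Fvec d x l =
      ∑ l : O, W (Sum.inl l) * N.fin x l + ∑ r, W (Sum.inr r) * d r - ∑ j, W j * N.fout x j := by
    simp only [Fintype.sum_sum_type, Fvec, Sum.elim_inl, Sum.elim_inr, mul_sub,
      Finset.sum_sub_distrib]
    ring
  rw [hsplit, hswap, add_sub_right_comm, ← Finset.sum_sub_distrib, add_comm, sub_eq_add_neg,
    ← Finset.sum_neg_distrib]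
  congr 1
  refine Finset.sum_congr rfl fun j _ => ?_
  rw [N.sum_β_mul_weight hmerge hW]
  split_ifs <;> ring

theorem fout_eq_demand_of_Lout_eq_empty (x : O ⊕ R → ℝ) {l : O ⊕ R}
    (h : N.Lout (N.head l) = ∅) : N.fout x l = N.demand x l := by
  have hα : {a : ℝ | a ∈ Set.Icc (0 : ℝ) 1} = Set.Icc 0 1 := rfl
  simp [fout, foutGen, αgen, h, -Set.mem_Icc, hα]

theorem sum_weight_mul_Fvec_antitone (hmerge : ∀ v : V, (N.Lout v).card ≤ 1) (d : R → ℝ)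
    {W : O ⊕ R → ℝ}
    (hW : ∀ l : O ⊕ R,
      (N.Lout (N.head l) = ∅ → W l = N.wgt l) ∧
      ∀ k ∈ N.Lout (N.head l), W l = N.wgt l * W (Sum.inl k))
    {x y : O ⊕ R → ℝ} (hx : N.memD x) (hy : N.memD y) (hxy : x ≤ y) :
    ∑ l, W l * N.Fvec d y l ≤ ∑ l, W l * N.Fvec d x l := by
  rw [N.sum_weight_mul_Fvec hmerge d (fun l => (hW l).2),
    N.sum_weight_mul_Fvec hmerge d (fun l => (hW l).2)]
  refine sub_le_sub_left (Finset.sum_le_sum fun j _ => ?_) _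
  split_ifs with h
  · rw [N.fout_eq_demand_of_Lout_eq_empty x h, N.fout_eq_demand_of_Lout_eq_empty y h]
    exact mul_le_mul_of_nonneg_left (N.demand_mono hx hy hxy j) (N.weight_nonneg hW j)
  · exact le_rfl

end TrafficNetwork

/-- **Lemma 2.** Consider a traffic network in which every
junction has at most one outgoing link and, at every junction, the offramp
fraction `γ_l = 1 − Σ_{k∈L^out_{σ(l)}} β_{lk}` equals a common value `Γ_v` for
all incoming links.  Define `w_l := 1 − Γ_{σ(l)}` if `Γ_{σ(l)} < 1` and
`w_l := 1` otherwise, and `W_l := w_{l_1}⋯w_{l_{n_l}}` along the unique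
directed path `l = l_1, …, l_{n_l}` from `l` to the sink junction (here `W` is
characterized by its recursion: `W_l = w_l` if `σ(l)` is a sink and
`W_l = w_l · W_k` for the outgoing link `k ∈ L^out_{σ(l)}` otherwise).  Then at
every density `ρ` in the interior of `D` at which the vector field `F` is
differentiable, the matrix `W·(∂F/∂ρ)(ρ)` is compartmental: its off-diagonal
entries are nonnegative and all its column sums are nonpositive. -/
theorem stmt18 {V O R : Type} [Fintype V] [Fintype O] [Fintype R]
    [DecidableEq V] [DecidableEq O] [DecidableEq R]
    (N : TrafficNetwork V O R) (hC1 : N.C1)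
    (d : R → ℝ) (hd : ∀ r, 0 ≤ d r)
    (hmerge : ∀ v : V, (N.Lout v).card ≤ 1)
    (hoff : ∀ v : V, ∃ Γ : ℝ, ∀ l ∈ N.Lin v, N.γfrac l = Γ)
    (W : O ⊕ R → ℝ)
    (hW : ∀ l : O ⊕ R,
      (N.Lout (N.head l) = ∅ → W l = N.wgt l) ∧
      ∀ k ∈ N.Lout (N.head l), W l = N.wgt l * W (Sum.inl k))
    (ρ : O ⊕ R → ℝ) (hρ : ρ ∈ interior N.Dset)
    (hdiff : DifferentiableAt ℝ (N.Fvec d) ρ) :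
    (∀ l k : O ⊕ R, l ≠ k →
      0 ≤ W l * fderiv ℝ (N.Fvec d) ρ (Pi.single k 1) l) ∧
    (∀ k : O ⊕ R,
      ∑ l : O ⊕ R, W l * fderiv ℝ (N.Fvec d) ρ (Pi.single k 1) l ≤ 0) := by
  have hF := hasFDerivAt_pi'.mp hdiff.hasFDerivAt
  have hρD : ρ ∈ N.Dset := interior_subset hρ
  have hle : ∀ (k : O ⊕ R) (t : ℝ), 0 ≤ t → ρ ≤ ρ + t • Pi.single k 1 := fun k t ht =>
    le_add_of_nonneg_right (smul_nonneg ht (Pi.single_nonneg.mpr zero_le_one))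
  constructor
  · intro l k hlk
    refine mul_nonneg (N.weight_nonneg hW l) ((hF l).apply_nonneg_of_le_on_ray hρ ?_)
    intro t ht htD
    exact N.Fvec_le_of_le hmerge d hρD htD (hle k t ht) (by simp [hlk])
  · intro k
    have hsum : HasFDerivAt (fun x => -∑ l, W l * N.Fvec d x l) _ ρ :=
      (HasFDerivAt.fun_sum fun l _ => (hF l).const_mul (W l)).neg
    have h := hsum.apply_nonneg_of_le_on_ray (v := Pi.single k 1) hρ fun t ht htD =>
      neg_le_neg (N.sum_weight_mul_Fvec_antitone hmerge d hW hρD htD (hle k t ht))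
    simpa [-Fintype.sum_sum_type] using h
end
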